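/- Let l ≥ 2, let β ∈ V_1 ⊖ S_1 and γ ∈ V_l ⊖ S_l be nonzero, and let X_β and X_γ be the closed linear spans in ℓ²(W) of {β_{m,n} : m, n ≥ 0} and {γ_{m,n} : m, n ≥ 0} respectively. Then there exists a bounded invertible linear map T : X_β → X_γ (an isomorphism of Banach spaces, with bounded inverse) such that T(β_{m,n}) = γ_{m,n} + γ_{m−1,n−1} for all m, n ≥ 0 (where γ_{m−1,n−1} = 0 if m = 0 or n = 0). -/

import Mathlib

noncomputable section

open scoped ComplexInnerProductSpace

namespace UCoxMasa

/-- The universal Coxeter matrix on `Fin L`: all off-diagonal entries are `0` (representing ∞). -/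
def Mat (L : ℕ) : CoxeterMatrix (Fin L) where
  M := fun i j => if i = j then 1 else 0
  isSymm := by
    ext i j
    by_cases h : i = j <;> simp [Matrix.transpose, h, eq_comm]
  diagonal := fun i => by simp
  off_diagonal := fun i j h => by simp [h]

/-- The universal Coxeter group on `L` generators: free product of `L` copies of `ℤ/2ℤ`. -/
abbrev W (L : ℕ) : Type := (Mat L).Group

/-- The distinguished Coxeter system of `W L`. -/
def cs (L : ℕ) : CoxeterSystem (Mat L) (W L) := CoxeterMatrix.toCoxeterSystem (Mat L)

/-- The simple reflection associated to `i : Fin L`. -/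
def σ {L : ℕ} (i : Fin L) : W L := (cs L).simple i

/-- Word length on `W L` with respect to the generating set of simple reflections. -/
def len {L : ℕ} (w : W L) : ℕ := (cs L).length w

/-- The Hilbert space `ℓ²(W)`. -/
abbrev H (L : ℕ) : Type := lp (fun _ : W L => ℂ) 2

/-- The standard orthonormal basis vector `δ_w` of `ℓ²(W)`. -/
def δ {L : ℕ} (w : W L) : H L :=
  letI := Classical.decEq (W L)
  lp.single 2 w 1

/-- `V l`: the linear span of `{δ_w : ℓ(w) = l}`. -/
def V (L : ℕ) (l : ℕ) : Submodule ℂ (H L) :=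
  Submodule.span ℂ {x : H L | ∃ w : W L, len w = l ∧ x = δ w}

/-- `S_l`: the linear span of `q_l(h V_{l-1}) ∪ q_l(R_h V_{l-1})`,
given the projections `Q`, the operator `h` and the right operator `Rh`. -/
def Sl (L : ℕ) (Q : ℕ → (H L →L[ℂ] H L)) (h Rh : H L →L[ℂ] H L) (l : ℕ) :
    Submodule ℂ (H L) :=
  Submodule.span ℂ
    ({x : H L | ∃ y ∈ V L (l - 1), x = Q l (h y)} ∪
      {x : H L | ∃ y ∈ V L (l - 1), x = Q l (Rh y)})

end UCoxMasa


namespace UCoxMasa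

section Domination

variable {ι E F G : Type*} [NormedAddCommGroup E] [NormedSpace ℂ E]
  [NormedAddCommGroup F] [NormedSpace ℂ F] [NormedAddCommGroup G] [NormedSpace ℂ G]

/-- The family `x` is dominated by the family `y`: finite linear combinations of `x` are bounded in
norm, up to a constant, by the combinations of `y` with the same coefficients. -/
def Dominated (x : ι → E) (y : ι → F) : Prop :=
  ∃ C : ℝ, 0 ≤ C ∧ ∀ a : ι →₀ ℂ,
    ‖Finsupp.linearCombination ℂ x a‖ ≤ C * ‖Finsupp.linearCombination ℂ y a‖

theorem Dominated.trans {x : ι → E} {y : ι → F} {z : ι → G}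
    (h : Dominated x y) (h' : Dominated y z) : Dominated x z := by
  obtain ⟨C, hC, h⟩ := h
  obtain ⟨C', hC', h'⟩ := h'
  refine ⟨C * C', by positivity, fun a => (h a).trans ?_⟩
  rw [mul_assoc]
  exact mul_le_mul_of_nonneg_left (h' a) hC

theorem denseRange_linearCombination_closure (x : ι → E) :
    DenseRange (Finsupp.linearCombination ℂ fun i =>
      (⟨x i, Submodule.le_topologicalClosure _ (Submodule.subset_span ⟨i, rfl⟩)⟩ :
        (Submodule.span ℂ (Set.range x)).topologicalClosure)) := by
  have key : ∀ a : ι →₀ ℂ, ((Finsupp.linearCombination ℂ (fun i =>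
      (⟨x i, Submodule.le_topologicalClosure _ (Submodule.subset_span ⟨i, rfl⟩)⟩ :
        (Submodule.span ℂ (Set.range x)).topologicalClosure)) a :
        (Submodule.span ℂ (Set.range x)).topologicalClosure) : E)
      = Finsupp.linearCombination ℂ x a := by
    intro a
    simp [Finsupp.linearCombination_apply, Finsupp.sum]
  intro z
  rw [closure_subtype]
  have hz : (z : E) ∈ closure (Submodule.span ℂ (Set.range x) : Set E) := z.2
  refine closure_mono ?_ hz
  intro v hv
  obtain ⟨a, rfl⟩ := (Finsupp.mem_span_range_iff_exists_finsupp).1 hv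
  exact ⟨_, ⟨a, rfl⟩, key a⟩

/-- Mutually dominated families have isomorphic closed spans. -/
theorem Dominated.exists_equiv [CompleteSpace E] [CompleteSpace F] {x : ι → E} {y : ι → F}
    (h : Dominated x y) (h' : Dominated y x) :
    ∃ T : (Submodule.span ℂ (Set.range x)).topologicalClosure ≃L[ℂ]
        (Submodule.span ℂ (Set.range y)).topologicalClosure,
      ∀ i hi, (T ⟨x i, hi⟩ : F) = y i := by
  obtain ⟨C, -, h⟩ := h
  obtain ⟨C', -, h'⟩ := h'
  have d₁ := denseRange_linearCombination_closure x
  have d₂ := denseRange_linearCombination_closure y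
  set e₁ := Finsupp.linearCombination ℂ fun i =>
      (⟨x i, Submodule.le_topologicalClosure _ (Submodule.subset_span ⟨i, rfl⟩)⟩ :
        (Submodule.span ℂ (Set.range x)).topologicalClosure) with he₁
  set e₂ := Finsupp.linearCombination ℂ fun i =>
      (⟨y i, Submodule.le_topologicalClosure _ (Submodule.subset_span ⟨i, rfl⟩)⟩ :
        (Submodule.span ℂ (Set.range y)).topologicalClosure) with he₂
  have k₁ : ∀ a, ‖e₁ a‖ = ‖Finsupp.linearCombination ℂ x a‖ := by
    intro a
    have e : ((e₁ a : _) : E) = Finsupp.linearCombination ℂ x a := by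
      simp [he₁, Finsupp.linearCombination_apply, Finsupp.sum]
    rw [← e]
    rfl
  have k₂ : ∀ a, ‖e₂ a‖ = ‖Finsupp.linearCombination ℂ y a‖ := by
    intro a
    have e : ((e₂ a : _) : F) = Finsupp.linearCombination ℂ y a := by
      simp [he₂, Finsupp.linearCombination_apply, Finsupp.sum]
    rw [← e]
    rfl
  have : CompleteSpace (Submodule.span ℂ (Set.range x)).topologicalClosure :=
    (Submodule.isClosed_topologicalClosure _).completeSpace_coe
  have : CompleteSpace (Submodule.span ℂ (Set.range y)).topologicalClosure :=
    (Submodule.isClosed_topologicalClosure _).completeSpace_coe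
  have b₁ : ∃ K, ∀ a, ‖e₂ (LinearEquiv.refl ℂ (ι →₀ ℂ) a)‖ ≤ K * ‖e₁ a‖ :=
    ⟨C', fun a => by rw [k₁, LinearEquiv.refl_apply, k₂]; exact h' a⟩
  have b₂ : ∃ K, ∀ a, ‖e₁ ((LinearEquiv.refl ℂ (ι →₀ ℂ)).symm a)‖ ≤ K * ‖e₂ a‖ :=
    ⟨C, fun a => by rw [k₂, LinearEquiv.refl_symm, LinearEquiv.refl_apply, k₁]; exact h a⟩
  refine ⟨(LinearEquiv.refl ℂ (ι →₀ ℂ)).extend e₁ e₂ d₁ b₁ d₂ b₂, fun i hi => ?_⟩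
  have := LinearEquiv.extend_eq (LinearEquiv.refl ℂ (ι →₀ ℂ)) e₁ e₂ d₁ b₁ d₂ b₂
    (Finsupp.single i 1)
  have h1 : e₁ (Finsupp.single i 1) = ⟨x i, hi⟩ := by simp [he₁]
  rw [h1] at this
  rw [this]
  simp [he₂]

end Domination

section Orthogonal

variable {ι E : Type*} [NormedAddCommGroup E] [InnerProductSpace ℂ E]

theorem norm_sq_linearCombination_of_orthogonal {u : ι → E}
    (hu : Pairwise fun i j => ⟪u i, u j⟫ = 0) (a : ι →₀ ℂ) :
    ‖Finsupp.linearCombination ℂ u a‖ ^ 2 = ∑ i ∈ a.support, (‖a i‖ * ‖u i‖) ^ 2 := by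
  rw [Finsupp.linearCombination_apply, Finsupp.sum, ← Complex.ofReal_inj]
  push_cast
  have := inner_self_eq_norm_sq_to_K (𝕜 := ℂ) (∑ i ∈ a.support, a i • u i)
  simp only [Complex.coe_algebraMap] at this
  rw [← this, sum_inner]
  refine Finset.sum_congr rfl fun i hi => ?_
  rw [inner_sum, Finset.sum_eq_single i]
  · rw [inner_self_eq_norm_sq_to_K, norm_smul]
    simp
  · intro j _ hj
    simp [inner_smul_left, inner_smul_right, hu hj.symm]
  · exact fun h => absurd hi h

theorem norm_linearCombination_le_of_orthogonal {u v : ι → E}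
    (hu : Pairwise fun i j => ⟪u i, u j⟫ = 0) (hv : Pairwise fun i j => ⟪v i, v j⟫ = 0)
    {r : ℝ} (hr : 0 ≤ r) (huv : ∀ i, ‖u i‖ ≤ r * ‖v i‖) (a : ι →₀ ℂ) :
    ‖Finsupp.linearCombination ℂ u a‖ ≤ r * ‖Finsupp.linearCombination ℂ v a‖ := by
  refine le_of_sq_le_sq ?_ (by positivity)
  rw [mul_pow, norm_sq_linearCombination_of_orthogonal hu,
    norm_sq_linearCombination_of_orthogonal hv, Finset.mul_sum]
  refine Finset.sum_le_sum fun i _ => ?_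
  rw [← mul_pow]
  refine pow_le_pow_left₀ (by positivity) ?_ 2
  calc ‖a i‖ * ‖u i‖ ≤ ‖a i‖ * (r * ‖v i‖) := by gcongr; exact huv i
    _ = r * (‖a i‖ * ‖v i‖) := by ring

theorem Dominated.of_orthogonal {u v : ι → E}
    (hu : Pairwise fun i j => ⟪u i, u j⟫ = 0) (hv : Pairwise fun i j => ⟪v i, v j⟫ = 0)
    {r : ℝ} (hr : 0 ≤ r) (huv : ∀ i, ‖u i‖ ≤ r * ‖v i‖) : Dominated u v :=
  ⟨r, hr, norm_linearCombination_le_of_orthogonal hu hv hr huv⟩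

theorem linearCombination_add_family (x y : ι → E) (a : ι →₀ ℂ) :
    Finsupp.linearCombination ℂ (fun i => x i + y i) a =
      Finsupp.linearCombination ℂ x a + Finsupp.linearCombination ℂ y a := by
  simp [Finsupp.linearCombination_apply, Finsupp.sum, Finset.sum_add_distrib]

/-- An orthogonal family stays equivalent to itself under a small orthogonal perturbation. -/
theorem dominated_add_of_orthogonal {u v : ι → E}
    (hu : Pairwise fun i j => ⟪u i, u j⟫ = 0) (hv : Pairwise fun i j => ⟪v i, v j⟫ = 0)
    (huv : ∀ i, ‖u i‖ ≤ 1 / 2 * ‖v i‖) :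
    Dominated (fun i => v i + u i) v ∧ Dominated v (fun i => v i + u i) := by
  have key := norm_linearCombination_le_of_orthogonal hu hv (by norm_num) huv
  refine ⟨⟨2, by norm_num, fun a => ?_⟩, ⟨2, by norm_num, fun a => ?_⟩⟩
  · rw [linearCombination_add_family]
    have := norm_add_le (Finsupp.linearCombination ℂ v a) (Finsupp.linearCombination ℂ u a)
    nlinarith [key a, norm_nonneg (Finsupp.linearCombination ℂ v a)]
  · rw [linearCombination_add_family]
    have := norm_sub_norm_le (Finsupp.linearCombination ℂ v a)
      (-Finsupp.linearCombination ℂ u a)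
    rw [sub_neg_eq_add, norm_neg] at this
    linarith [key a]

end Orthogonal

section Gram

variable {E : Type*} [NormedAddCommGroup E] [InnerProductSpace ℂ E]

/-- The family `x` is graded by `m + n`, and its Gram matrix in each degree is the Toeplitz-type
matrix with parameters `c`, `d`, `r`. -/
structure HasGram (x : ℕ × ℕ → E) (c d r : ℝ) : Prop where
  graded : ∀ m n m' n', m + n ≠ m' + n' → ⟪x (m, n), x (m', n')⟫ = 0
  toeplitz : ∀ m k n, ⟪x (m + k, n), x (m, n + k)⟫ = ((c * d ^ (m + n) * r ^ k : ℝ) : ℂ)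

variable {x y : ℕ × ℕ → E} {c d r : ℝ}

theorem HasGram.toeplitz_symm (h : HasGram x c d r) (m k n : ℕ) :
    ⟪x (m, n + k), x (m + k, n)⟫ = ((c * d ^ (m + n) * r ^ k : ℝ) : ℂ) := by
  rw [← inner_conj_symm, h.toeplitz, Complex.conj_ofReal]

theorem HasGram.norm_sq (h : HasGram x c d r) (m n : ℕ) :
    ‖x (m, n)‖ ^ 2 = c * d ^ (m + n) := by
  have := h.toeplitz m 0 n
  rw [add_zero, add_zero, inner_self_eq_norm_sq_to_K] at this
  have h2 : ((‖x (m, n)‖ ^ 2 : ℝ) : ℂ) = ((c * d ^ (m + n) * r ^ 0 : ℝ) : ℂ) := by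
    rw [← this]; simp
  rw [Complex.ofReal_inj] at h2
  simpa using h2

theorem HasGram.orthogonal (h : HasGram x c d 0) : Pairwise fun i j => ⟪x i, x j⟫ = 0 := by
  rintro ⟨m, n⟩ ⟨m', n'⟩ hne
  by_cases hd : m + n = m' + n'
  · rcases lt_trichotomy m m' with hlt | rfl | hlt
    · obtain ⟨k, rfl⟩ := Nat.exists_eq_add_of_lt hlt
      obtain rfl : n = n' + (k + 1) := by omega
      have := h.toeplitz_symm m (k + 1) n'
      simpa [add_assoc] using this
    · exact absurd (by rw [show n = n' by omega]) hne
    · obtain ⟨k, rfl⟩ := Nat.exists_eq_add_of_lt hlt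
      obtain rfl : n' = n + (k + 1) := by omega
      have := h.toeplitz m' (k + 1) n
      simpa [add_assoc] using this
  · exact h.graded _ _ _ _ hd

/-- `x (m, n)` plus its neighbour `d⁻¹ • x (m - 1, n + 1)` in the same degree. -/
def stepFamily (d : ℝ) (x : ℕ × ℕ → E) (i : ℕ × ℕ) : E :=
  x i + (if i.1 = 0 then 0 else ((d⁻¹ : ℝ) : ℂ) • x (i.1 - 1, i.2 + 1))

/-- `x (m, n)` plus its predecessor `x (m - 1, n - 1)`. -/
def diagFamily (x : ℕ × ℕ → E) (i : ℕ × ℕ) : E :=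
  x i + (if i.1 = 0 ∨ i.2 = 0 then 0 else x (i.1 - 1, i.2 - 1))

theorem HasGram.inner_stepFamily (h : HasGram x c d (-1)) (hd : 0 < d) (m k n : ℕ) :
    ⟪x (m, n + (k + 1)), stepFamily d x (m + (k + 1), n)⟫ = 0 := by
  have h1 := h.toeplitz_symm m (k + 1) n
  have h2 := h.toeplitz_symm m k (n + 1)
  have e : n + 1 + k = n + (k + 1) := by ring
  rw [e] at h2
  simp only [stepFamily, inner_add_right, h1, if_neg (show ¬ m + (k + 1) = 0 by omega),
    inner_smul_right, show m + (k + 1) - 1 = m + k by omega, h2]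
  rw [← Complex.ofReal_mul, ← Complex.ofReal_add, Complex.ofReal_eq_zero]
  field_simp
  ring

theorem HasGram.orthogonal_stepFamily (h : HasGram x c d (-1)) (hd : 0 < d) :
    Pairwise fun i j => ⟪stepFamily d x i, stepFamily d x j⟫ = 0 := by
  have main : ∀ m k n, ⟪stepFamily d x (m, n + (k + 1)), stepFamily d x (m + (k + 1), n)⟫ = 0 := by
    intro m k n
    rw [stepFamily, inner_add_left, h.inner_stepFamily hd, zero_add]
    rcases m with _ | m
    · simp
    · simp only [Nat.add_eq_zero_iff, one_ne_zero, and_false, if_false, inner_smul_left,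
        Nat.add_sub_cancel]
      have := h.inner_stepFamily hd m (k + 1) n
      rw [show m + (k + 1 + 1) = m + 1 + (k + 1) by ring] at this
      rw [show n + (k + 1) + 1 = n + (k + 1 + 1) by ring, this, mul_zero]
  rintro ⟨m, n⟩ ⟨m', n'⟩ hne
  by_cases hdeg : m + n = m' + n'
  · rcases lt_trichotomy m m' with hlt | rfl | hlt
    · obtain ⟨k, rfl⟩ := Nat.exists_eq_add_of_lt hlt
      obtain rfl : n = n' + (k + 1) := by omega
      exact main m k n'
    · exact absurd (by rw [show n = n' by omega]) hne
    · obtain ⟨k, rfl⟩ := Nat.exists_eq_add_of_lt hlt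
      obtain rfl : n' = n + (k + 1) := by omega
      rw [← inner_conj_symm]
      exact (congrArg _ (main m' k n)).trans (map_zero _)
  · have g : ∀ a b a' b', a + b = m + n → a' + b' = m' + n' → ⟪x (a, b), x (a', b')⟫ = 0 :=
      fun a b a' b' h1 h2 => h.graded _ _ _ _ (by omega)
    simp only [stepFamily, inner_add_left, inner_add_right]
    split_ifs with h1 h2 h2 <;>
      simp only [inner_smul_left, inner_smul_right, inner_zero_left, inner_zero_right] <;>
      repeat rw [g _ _ _ _ (by omega) (by omega)]
    all_goals simp

theorem HasGram.norm_sq_stepFamily (h : HasGram x c d (-1)) (hd : 0 < d) (m n : ℕ) :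
    ‖stepFamily d x (m, n)‖ ^ 2 = if m = 0 then c * d ^ n else c * d ^ (m + n) * (1 - (d⁻¹) ^ 2) := by
  rcases m with _ | m
  · simpa [stepFamily] using h.norm_sq 0 n
  · simp only [Nat.add_eq_zero_iff, one_ne_zero, and_false, if_false]
    have h1 := h.inner_stepFamily hd m 0 n
    have h2 : ⟪stepFamily d x (m + 1, n), stepFamily d x (m + 1, n)⟫ =
        ((c * d ^ (m + 1 + n) * (1 - (d⁻¹) ^ 2) : ℝ) : ℂ) := by
      conv_lhs => arg 2; rw [stepFamily]
      simp only [Nat.add_eq_zero_iff, one_ne_zero, and_false, if_false, inner_add_left,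
        inner_smul_left, Nat.add_sub_cancel]
      simp only [zero_add] at h1
      rw [h1, mul_zero, add_zero]
      have h3 := h.toeplitz (m + 1) 0 n
      have h4 := h.toeplitz m 1 n
      simp only [add_zero] at h3
      simp only [stepFamily, inner_add_right, h3, Nat.add_eq_zero_iff, one_ne_zero, and_false,
        if_false, inner_smul_right, Nat.add_sub_cancel, h4]
      rw [← Complex.ofReal_mul, ← Complex.ofReal_add, Complex.ofReal_inj]
      field_simp
      ring
    rw [inner_self_eq_norm_sq_to_K] at h2
    rw [← Complex.ofReal_inj, ← h2]
    simp

/-- Transporting domination along the change of basis given by `stepFamily`. -/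
theorem Dominated.of_stepFamily (h : Dominated (stepFamily d x) (stepFamily d y)) :
    Dominated x y := by
  obtain ⟨C, hC, h⟩ := h
  refine ⟨C, hC, fun a => ?_⟩
  have key : ∀ m n, ((x (m, n), y (m, n)) : E × E) ∈ Submodule.span ℂ
      (Set.range fun i => (stepFamily d x i, stepFamily d y i)) := by
    intro m
    induction m with
    | zero =>
      intro n
      refine Submodule.subset_span ⟨(0, n), ?_⟩
      simp [stepFamily]
    | succ m ih =>
      intro n
      have h1 : ((stepFamily d x (m + 1, n), stepFamily d y (m + 1, n)) : E × E) ∈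
          Submodule.span ℂ (Set.range fun i => (stepFamily d x i, stepFamily d y i)) :=
        Submodule.subset_span ⟨(m + 1, n), rfl⟩
      have := Submodule.sub_mem _ h1 (Submodule.smul_mem _ ((d⁻¹ : ℝ) : ℂ) (ih (n + 1)))
      convert this using 1
      simp [stepFamily]
  have mem : ((Finsupp.linearCombination ℂ x a, Finsupp.linearCombination ℂ y a) : E × E) ∈
      Submodule.span ℂ (Set.range fun i => (stepFamily d x i, stepFamily d y i)) := by
    have e : ((Finsupp.linearCombination ℂ x a, Finsupp.linearCombination ℂ y a) : E × E) =
        ∑ i ∈ a.support, a i • (x i, y i) := by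
      simp [Finsupp.linearCombination_apply, Finsupp.sum, Prod.ext_iff, Prod.fst_sum, Prod.snd_sum]
    rw [e]
    exact Submodule.sum_mem _ fun i _ => Submodule.smul_mem _ _ (key i.1 i.2)
  obtain ⟨b, hb⟩ := Finsupp.mem_span_range_iff_exists_finsupp.1 mem
  have hb' := Prod.ext_iff.1 hb
  simp only [Finsupp.sum, Prod.fst_sum, Prod.snd_sum, Prod.smul_fst, Prod.smul_snd] at hb'
  have := h b
  rw [Finsupp.linearCombination_apply, Finsupp.linearCombination_apply, Finsupp.sum, Finsupp.sum,
    hb'.1, hb'.2] at this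
  exact this

theorem span_diagFamily (x : ℕ × ℕ → E) :
    Submodule.span ℂ (Set.range (diagFamily x)) = Submodule.span ℂ (Set.range x) := by
  apply le_antisymm
  · rw [Submodule.span_le]
    rintro _ ⟨i, rfl⟩
    refine Submodule.add_mem _ (Submodule.subset_span ⟨i, rfl⟩) ?_
    split_ifs
    · exact Submodule.zero_mem _
    · exact Submodule.subset_span ⟨_, rfl⟩
  · rw [Submodule.span_le]
    rintro _ ⟨⟨m, n⟩, rfl⟩
    induction m generalizing n with
    | zero => exact Submodule.subset_span ⟨(0, n), by simp [diagFamily]⟩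
    | succ m ih =>
      rcases n with _ | n
      · exact Submodule.subset_span ⟨(m + 1, 0), by simp [diagFamily]⟩
      · have h1 : diagFamily x (m + 1, n + 1) ∈ Submodule.span ℂ (Set.range (diagFamily x)) :=
          Submodule.subset_span ⟨_, rfl⟩
        have := Submodule.sub_mem _ h1 (ih n)
        simpa [diagFamily] using this

theorem norm_le_mul_of_sq_le {E : Type*} [SeminormedAddCommGroup E] {a b : E} {r : ℝ} (hr : 0 ≤ r)
    (h : ‖a‖ ^ 2 ≤ r ^ 2 * ‖b‖ ^ 2) :
    ‖a‖ ≤ r * ‖b‖ := by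
  rw [← mul_pow] at h
  exact le_of_sq_le_sq h (by positivity)

theorem HasGram.dominated_stepFamily_self (h : HasGram x c d 0) (hc : 0 < c) (hd : 2 ≤ d) :
    Dominated (stepFamily d x) x ∧ Dominated x (stepFamily d x) := by
  have hd0 : 0 < d := by linarith
  have ho := h.orthogonal
  refine dominated_add_of_orthogonal ?_ ho ?_
  · rintro ⟨m, n⟩ ⟨m', n'⟩ hne
    dsimp only
    split_ifs with h1 h2 h2
    · simp
    · simp
    · simp
    · rw [inner_smul_left, inner_smul_right, ho, mul_zero, mul_zero]
      simp only [ne_eq, Prod.mk.injEq] at hne ⊢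
      omega
  · rintro ⟨m, n⟩
    rcases m with _ | m
    · simp
    · simp only [Nat.add_eq_zero_iff, one_ne_zero, and_false, if_false, Nat.add_sub_cancel]
      refine norm_le_mul_of_sq_le (by norm_num) ?_
      rw [norm_smul, mul_pow, h.norm_sq, h.norm_sq, Complex.norm_real, Real.norm_eq_abs, sq_abs,
        show m + (n + 1) = m + 1 + n by ring]
      refine mul_le_mul_of_nonneg_right ?_ (by positivity)
      exact pow_le_pow_left₀ (by positivity) (by
        rw [one_div]; exact inv_anti₀ (by norm_num) hd) 2

theorem HasGram.dominated_diagFamily_self (h : HasGram x c d 0) (hc : 0 < c) (hd : 2 ≤ d) :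
    Dominated (diagFamily x) x ∧ Dominated x (diagFamily x) := by
  have hd0 : 0 < d := by linarith
  have ho := h.orthogonal
  refine dominated_add_of_orthogonal ?_ ho ?_
  · rintro ⟨m, n⟩ ⟨m', n'⟩ hne
    dsimp only
    split_ifs with h1 h2 h2
    · simp
    · simp
    · simp
    · rw [ho]
      simp only [ne_eq, Prod.mk.injEq] at hne ⊢
      omega
  · rintro ⟨m, n⟩
    dsimp only
    split_ifs with h1
    · simp
    · obtain ⟨m, rfl⟩ := Nat.exists_eq_succ_of_ne_zero (show m ≠ 0 by omega)
      obtain ⟨n, rfl⟩ := Nat.exists_eq_succ_of_ne_zero (show n ≠ 0 by omega)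
      refine norm_le_mul_of_sq_le (by norm_num) ?_
      simp only [Nat.succ_eq_add_one, Nat.add_sub_cancel]
      rw [h.norm_sq, h.norm_sq, show m + 1 + (n + 1) = m + n + 2 by ring, pow_add d (m + n) 2]
      have : 0 ≤ c * d ^ (m + n) := by positivity
      nlinarith [mul_le_mul_of_nonneg_left (show (4 : ℝ) ≤ d ^ 2 by nlinarith) this]

theorem HasGram.dominated_diagFamily {c' : ℝ} (hx : HasGram x c d (-1)) (hy : HasGram y c' d 0)
    (hc : 0 < c) (hc' : 0 < c') (hd : 2 ≤ d) :
    Dominated x (diagFamily y) ∧ Dominated (diagFamily y) x := by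
  have hd0 : 0 < d := by linarith
  have ho := hx.orthogonal_stepFamily hd0
  have ho' := hy.orthogonal
  obtain ⟨s₁, s₂⟩ := hy.dominated_stepFamily_self hc' hd
  obtain ⟨t₁, t₂⟩ := hy.dominated_diagFamily_self hc' hd
  have hinv : (d⁻¹) ^ 2 ≤ 1 / 4 := by
    calc (d⁻¹) ^ 2 ≤ (2⁻¹ : ℝ) ^ 2 :=
          pow_le_pow_left₀ (by positivity) (inv_anti₀ (by norm_num) hd) 2
      _ = 1 / 4 := by norm_num
  have u₁ : Dominated (stepFamily d x) y := by
    refine Dominated.of_orthogonal ho ho' (Real.sqrt_nonneg (c / c')) ?_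
    rintro ⟨m, n⟩
    refine norm_le_mul_of_sq_le (Real.sqrt_nonneg _) ?_
    rw [hx.norm_sq_stepFamily hd0, hy.norm_sq, Real.sq_sqrt (by positivity)]
    have e : c / c' * (c' * d ^ (m + n)) = c * d ^ (m + n) := by field_simp
    rw [e]
    split_ifs with hm
    · simp [hm]
    · have : 0 ≤ c * d ^ (m + n) := by positivity
      nlinarith [sq_nonneg (d⁻¹)]
  have u₂ : Dominated y (stepFamily d x) := by
    refine Dominated.of_orthogonal ho' ho (Real.sqrt_nonneg (2 * (c' / c))) ?_
    rintro ⟨m, n⟩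
    refine norm_le_mul_of_sq_le (Real.sqrt_nonneg _) ?_
    rw [hx.norm_sq_stepFamily hd0, hy.norm_sq, Real.sq_sqrt (by positivity)]
    have : 0 ≤ c' * d ^ (m + n) := by positivity
    split_ifs with hm
    · subst hm
      rw [zero_add] at *
      have e : 2 * (c' / c) * (c * d ^ n) = 2 * (c' * d ^ n) := by field_simp
      rw [e]; linarith
    · have e : 2 * (c' / c) * (c * d ^ (m + n) * (1 - (d⁻¹) ^ 2)) =
          2 * (c' * d ^ (m + n)) * (1 - (d⁻¹) ^ 2) := by field_simp
      rw [e]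
      nlinarith
  exact ⟨(Dominated.of_stepFamily (u₁.trans s₂)).trans t₂,
    t₁.trans (Dominated.of_stepFamily (s₁.trans u₂))⟩

theorem HasGram.exists_equiv [CompleteSpace E] {c' : ℝ} (hx : HasGram x c d (-1))
    (hy : HasGram y c' d 0) (hc : 0 < c) (hc' : 0 < c') (hd : 2 ≤ d) :
    ∃ T : (Submodule.span ℂ (Set.range x)).topologicalClosure ≃L[ℂ]
        (Submodule.span ℂ (Set.range y)).topologicalClosure,
      ∀ i hi, (T ⟨x i, hi⟩ : E) = diagFamily y i := by
  obtain ⟨h₁, h₂⟩ := hx.dominated_diagFamily hy hc hc' hd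
  have := h₁.exists_equiv h₂
  rwa [span_diagFamily] at this

end Gram

section Words

variable {L : ℕ}

/-- The product in `W L` of a word in the generators. -/
def word (l : List (Fin L)) : W L := (cs L).wordProd l

/-- A word is reduced when no two adjacent letters agree. -/
abbrev Red (l : List (Fin L)) : Prop := l.IsChain (· ≠ ·)

theorem word_cons (s : Fin L) (l : List (Fin L)) : word (s :: l) = σ s * word l :=
  (cs L).wordProd_cons s l

theorem word_append (l l' : List (Fin L)) : word (l ++ l') = word l * word l' :=
  (cs L).wordProd_append l l'

theorem word_append_singleton (l : List (Fin L)) (s : Fin L) :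
    word (l ++ [s]) = word l * σ s := by
  rw [word_append]
  exact congrArg _ ((cs L).wordProd_singleton s)

theorem word_cons_cons_self (s : Fin L) (l : List (Fin L)) : word (s :: s :: l) = word l := by
  rw [word_cons, word_cons]
  exact (cs L).simple_mul_simple_cancel_left s

theorem word_append_self (l : List (Fin L)) (s : Fin L) :
    word (l ++ [s] ++ [s]) = word l := by
  rw [word_append_singleton, word_append_singleton]
  exact (cs L).simple_mul_simple_cancel_right s

/-- Left multiplication by a generator, on reduced words. -/
def leftStep (s : Fin L) (l : {l : List (Fin L) // Red l}) : {l : List (Fin L) // Red l} :=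
  if h : Red (s :: l.1) then ⟨s :: l.1, h⟩ else ⟨l.1.tail, l.2.tail⟩

theorem exists_eq_cons_of_not_red {s : Fin L} {l : List (Fin L)} (hl : Red l)
    (h : ¬ Red (s :: l)) : ∃ t, l = s :: t := by
  rcases l with _ | ⟨a, t⟩
  · simp at h
  · refine ⟨t, ?_⟩
    rw [Red, List.isChain_cons_cons] at h
    by_contra hne
    exact h ⟨fun hsa => hne (by rw [hsa]), hl⟩

theorem exists_eq_append_of_not_red {s : Fin L} {l : List (Fin L)} (hl : Red l)
    (h : ¬ Red (l ++ [s])) : ∃ t, l = t ++ [s] := by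
  rcases List.eq_nil_or_concat l with rfl | ⟨t, a, rfl⟩
  · simp at h
  · refine ⟨t, ?_⟩
    rw [List.concat_eq_append] at *
    by_contra hne
    refine h (List.isChain_append.2 ⟨hl, by simp, ?_⟩)
    simp only [List.getLast?_append, List.getLast?_singleton, List.head?_cons]
    rintro x hx y hy rfl
    simp at hx hy
    exact hne (by rw [hx, hy])

theorem leftStep_leftStep (s : Fin L) (l : {l : List (Fin L) // Red l}) :
    leftStep s (leftStep s l) = l := by
  obtain ⟨l, hl⟩ := l
  by_cases h : Red (s :: l)
  · have h' : ¬ Red (s :: s :: l) := by simp [Red]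
    simp [leftStep, h, h']
  · obtain ⟨t, rfl⟩ := exists_eq_cons_of_not_red hl h
    simp [leftStep, h, hl]

/-- The action of `W L` on reduced words. -/
def wordAction (L : ℕ) : W L →* Function.End {l : List (Fin L) // Red l} :=
  (cs L).lift ⟨leftStep, fun i j => by
    by_cases h : i = j
    · subst h
      rw [(Mat L).diagonal, pow_one]
      exact funext (leftStep_leftStep i)
    · have : (Mat L).M i j = 0 := if_neg h
      rw [this, pow_zero]⟩

theorem wordAction_simple (s : Fin L) : wordAction L (σ s) = leftStep s :=
  (cs L).lift_apply_simple _ s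

/-- The reduced word representing an element of `W L`. -/
def normalForm (w : W L) : {l : List (Fin L) // Red l} := wordAction L w ⟨[], List.isChain_nil⟩

theorem normalForm_simple_mul (s : Fin L) (w : W L) :
    normalForm (σ s * w) = leftStep s (normalForm w) := by
  rw [normalForm, map_mul, wordAction_simple]
  rfl

theorem normalForm_one : normalForm (1 : W L) = ⟨[], List.isChain_nil⟩ := by
  rw [normalForm, map_one]
  rfl

theorem normalForm_word {l : List (Fin L)} (hl : Red l) : normalForm (word l) = ⟨l, hl⟩ := by
  induction l with
  | nil => exact ((congrArg _ ((cs L).wordProd_nil)).trans normalForm_one)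
  | cons s l ih => rw [word_cons, normalForm_simple_mul, ih hl.tail, leftStep, dif_pos hl]

theorem word_injective {l l' : List (Fin L)} (hl : Red l) (hl' : Red l')
    (h : word l = word l') : l = l' := by
  have := normalForm_word hl
  rw [h, normalForm_word hl'] at this
  exact (congrArg Subtype.val this).symm

theorem length_normalForm_word_le (l : List (Fin L)) :
    (normalForm (word l)).1.length ≤ l.length := by
  induction l with
  | nil => exact (congrArg (fun x => x.1.length)
      ((congrArg normalForm ((cs L).wordProd_nil)).trans normalForm_one)).le
  | cons s l ih =>
    rw [word_cons, normalForm_simple_mul, leftStep]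
    split_ifs
    · simpa using ih
    · simp only [List.length_tail, List.length_cons]
      omega

theorem len_word_le (l : List (Fin L)) : len (word l) ≤ l.length :=
  (cs L).length_wordProd_le l

theorem len_word {l : List (Fin L)} (hl : Red l) : len (word l) = l.length := by
  refine le_antisymm (len_word_le l) ?_
  obtain ⟨ω, hω, h⟩ := (cs L).exists_isReduced (word l)
  have h1 := length_normalForm_word_le ω
  have h2 : word l = word ω := h
  rw [← h2, normalForm_word hl] at h1
  have h3 : len (word ω) = ω.length := hω
  rw [h2, h3]
  exact h1

theorem exists_word_eq (w : W L) : ∃ l : List (Fin L), Red l ∧ word l = w := by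
  obtain ⟨ω, rfl⟩ := (cs L).wordProd_surjective w
  induction ω with
  | nil => exact ⟨[], List.isChain_nil, rfl⟩
  | cons s ω ih =>
    obtain ⟨l, hl, h⟩ := ih
    have e : (cs L).wordProd (s :: ω) = word (s :: l) := by
      rw [word_cons, h]; exact (cs L).wordProd_cons s ω
    rw [e]
    by_cases hs : Red (s :: l)
    · exact ⟨_, hs, rfl⟩
    · obtain ⟨t, rfl⟩ := exists_eq_cons_of_not_red hl hs
      exact ⟨t, hl.tail, (word_cons_cons_self s t).symm⟩

/-- The reduced words of length `n`. -/
def sphere (L n : ℕ) : Finset (List (Fin L)) :=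
  ((List.finite_length_eq (Fin L) n).subset
    (fun _ h => h.1 : {l : List (Fin L) | l.length = n ∧ Red l} ⊆ _)).toFinset

theorem mem_sphere {n : ℕ} {l : List (Fin L)} : l ∈ sphere L n ↔ l.length = n ∧ Red l := by
  simp [sphere]

theorem sphere_one : sphere L 1 = Finset.univ.image fun t : Fin L => [t] := by
  ext l
  simp only [mem_sphere, Finset.mem_image, Finset.mem_univ, true_and, List.length_eq_one_iff]
  constructor
  · rintro ⟨⟨a, rfl⟩, -⟩
    exact ⟨a, rfl⟩
  · rintro ⟨a, rfl⟩
    exact ⟨⟨a, rfl⟩, by simp⟩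

theorem sum_sphere_one {M : Type*} [AddCommMonoid M] (f : List (Fin L) → M) :
    ∑ l ∈ sphere L 1, f l = ∑ t, f [t] := by
  rw [sphere_one, Finset.sum_image fun a _ b _ h => List.singleton_injective h]

theorem sum_sphere_add {M : Type*} [AddCommMonoid M] (a b : ℕ) (f : List (Fin L) → M) :
    ∑ z ∈ sphere L (a + b), f z =
      ∑ u ∈ sphere L a, ∑ v ∈ sphere L b, if Red (u ++ v) then f (u ++ v) else 0 := by
  rw [← Finset.sum_product', ← Finset.sum_filter]
  refine Finset.sum_bij' (fun z _ => (z.take a, z.drop a)) (fun p _ => p.1 ++ p.2) ?_ ?_ ?_ ?_ ?_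
  · intro z hz
    obtain ⟨h1, h2⟩ := mem_sphere.1 hz
    simp only [Finset.mem_filter, Finset.mem_product, mem_sphere, List.take_append_drop]
    refine ⟨⟨⟨?_, h2.take a⟩, ⟨?_, h2.drop a⟩⟩, h2⟩
    · simp [h1]
    · simp [h1]
  · rintro ⟨u, v⟩ h
    simp only [Finset.mem_filter, Finset.mem_product, mem_sphere] at h ⊢
    exact ⟨by rw [List.length_append]; omega, h.2⟩
  · intro z _
    simp
  · rintro ⟨u, v⟩ h
    simp only [Finset.mem_filter, Finset.mem_product, mem_sphere] at h
    simp [← h.1.1.1]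
  · intro z _
    simp

theorem red_append_singleton_iff {l : List (Fin L)} (hl : Red l) (hne : l ≠ []) (t : Fin L) :
    Red (l ++ [t]) ↔ l.getLast hne ≠ t := by
  rw [Red, List.isChain_append]
  simp [hl, List.getLast?_eq_getLast_of_ne_nil hne]

theorem red_cons_iff {l : List (Fin L)} (hl : Red l) (hne : l ≠ []) (t : Fin L) :
    Red (t :: l) ↔ l.head hne ≠ t := by
  rw [Red, List.isChain_cons]
  simp [hl, List.head?_eq_some_head hne, eq_comm]

theorem sum_ite_ne_const (a : Fin L) (x : ℂ) :
    (∑ t : Fin L, if a ≠ t then x else 0) = ((L : ℂ) - 1) * x := by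
  have := Finset.sum_ite_eq Finset.univ a (fun _ : Fin L => x)
  have h2 : ∑ t : Fin L, (if a ≠ t then x else 0) + ∑ t : Fin L, (if a = t then x else 0)
      = ∑ t : Fin L, x := by
    rw [← Finset.sum_add_distrib]
    refine Finset.sum_congr rfl fun t _ => ?_
    by_cases h : a = t <;> simp [h]
  rw [this] at h2
  simp only [Finset.mem_univ, if_true, Finset.sum_const, Finset.card_univ, Fintype.card_fin,
    nsmul_eq_mul] at h2
  linear_combination h2

/-- The correlation on the sphere of radius `k` of two subwords of length `l`, starting at
positions `m` and `m'`. -/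
def corr (c : List (Fin L) → ℂ) (l k m m' : ℕ) : ℂ :=
  ∑ z ∈ sphere L k, starRingEnd ℂ (c ((z.drop m).take l)) * c ((z.drop m').take l)

theorem corr_succ_succ (c : List (Fin L) → ℂ) (l k m m' : ℕ) (hk : 1 ≤ k) :
    corr c l (k + 1) (m + 1) (m' + 1) = ((L : ℂ) - 1) * corr c l k m m' := by
  rw [corr, add_comm k 1, sum_sphere_add, Finset.sum_comm, corr, Finset.mul_sum]
  refine Finset.sum_congr rfl fun v hv => ?_
  obtain ⟨h1, h2⟩ := mem_sphere.1 hv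
  have hne : v ≠ [] := by rintro rfl; simp at h1; omega
  rw [sum_sphere_one, ← sum_ite_ne_const (v.head hne)]
  refine Finset.sum_congr rfl fun t _ => ?_
  simp only [List.singleton_append, red_cons_iff h2 hne, List.drop_succ_cons]

theorem corr_right_succ (c : List (Fin L) → ℂ) (l k m m' : ℕ) (hk : 1 ≤ k) (hm : m + l ≤ k)
    (hm' : m' + l ≤ k) :
    corr c l (k + 1) m m' = ((L : ℂ) - 1) * corr c l k m m' := by
  rw [corr, sum_sphere_add, corr, Finset.mul_sum]
  refine Finset.sum_congr rfl fun v hv => ?_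
  obtain ⟨h1, h2⟩ := mem_sphere.1 hv
  have hne : v ≠ [] := by rintro rfl; simp at h1; omega
  rw [sum_sphere_one, ← sum_ite_ne_const (v.getLast hne)]
  refine Finset.sum_congr rfl fun t _ => ?_
  have e : ∀ i, i + l ≤ k → ((v ++ [t]).drop i).take l = (v.drop i).take l := by
    intro i hi
    rw [List.drop_append_of_le_length (by omega), List.take_append_of_le_length (by simp; omega)]
  simp only [red_append_singleton_iff h2 hne, e m hm, e m' hm']

/-- `c` has boundary parameter `r` at length `l`: summing over the last letter of a reduced word
of which `c` sees the last `l` letters multiplies by `r` and shifts the window. -/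
def BoundaryParam (c : List (Fin L) → ℂ) (l : ℕ) (r : ℝ) : Prop :=
  ∀ (v : List (Fin L)) (k : ℕ), Red v → v.length = l + k →
    (∑ t, if Red (v ++ [t]) then c (v.drop (k + 1) ++ [t]) else 0) = (r : ℂ) * c (v.drop k)

theorem BoundaryParam.corr_succ_zero {c : List (Fin L) → ℂ} {l : ℕ} {r : ℝ}
    (h : BoundaryParam c l r) (hl : 1 ≤ l) (k : ℕ) :
    corr c l (l + (k + 1)) (k + 1) 0 = r * corr c l (l + k) k 0 := by
  rw [corr, ← add_assoc, sum_sphere_add, corr, Finset.mul_sum]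
  refine Finset.sum_congr rfl fun v hv => ?_
  obtain ⟨h1, h2⟩ := mem_sphere.1 hv
  have := congrArg (starRingEnd ℂ) (h v k h2 h1)
  rw [map_mul, Complex.conj_ofReal, map_sum] at this
  rw [sum_sphere_one, List.drop_zero, List.take_of_length_le (l := v.drop k) (by simp; omega),
    ← mul_assoc, ← this, Finset.sum_mul]
  refine Finset.sum_congr rfl fun t _ => ?_
  split_ifs
  · rw [List.drop_zero, List.take_append_of_le_length (by omega),
      List.drop_append_of_le_length (by omega), List.take_of_length_le (by simp; omega)]
  · simp

theorem BoundaryParam.corr_eq {c : List (Fin L) → ℂ} {l : ℕ} {r : ℝ}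
    (h : BoundaryParam c l r) (hl : 1 ≤ l) (m k n : ℕ) :
    corr c l (m + k + n + l) (m + k) m = ((L : ℂ) - 1) ^ (m + n) * r ^ k * corr c l l 0 0 := by
  induction m with
  | succ m ih =>
    rw [show m + 1 + k + n + l = (m + k + n + l) + 1 by ring, show m + 1 + k = m + k + 1 by ring,
      corr_succ_succ _ _ _ _ _ (by omega), ih]
    ring
  | zero =>
    simp only [zero_add]
    induction n with
    | succ n ih =>
      rw [show k + (n + 1) + l = (k + n + l) + 1 by ring,
        corr_right_succ _ _ _ _ _ (by omega) (by omega) (by omega), ih]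
      ring
    | zero =>
      induction k with
      | zero => simp
      | succ k ih =>
        rw [show k + 1 + 0 + l = l + (k + 1) by ring, h.corr_succ_zero hl,
          show l + k = k + 0 + l by ring, ih]
        ring

end Words

section Spheres

variable {L : ℕ}

theorem inner_δ_left (w : W L) (f : H L) : ⟪δ w, f⟫ = f w := by
  classical
  rw [δ]
  convert lp.inner_single_left (𝕜 := ℂ) w (1 : ℂ) f using 1
  simp

theorem inner_δ_δ (v w : W L) [Decidable (v = w)] : ⟪δ v, δ w⟫ = if v = w then (1 : ℂ) else 0 := by
  classical
  rw [inner_δ_left, δ, lp.single_apply, Pi.single_apply]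
  congr 1

/-- The vector supported on the sphere of radius `k` with coefficients `c`. -/
def sphereVec (c : List (Fin L) → ℂ) (k : ℕ) : H L := ∑ v ∈ sphere L k, c v • δ (word v)

theorem inner_sphereVec_δ (c : List (Fin L) → ℂ) {k : ℕ} {z : List (Fin L)}
    (hz : z ∈ sphere L k) : ⟪sphereVec c k, δ (word z)⟫ = starRingEnd ℂ (c z) := by
  classical
  rw [sphereVec, sum_inner, Finset.sum_eq_single z]
  · rw [inner_smul_left, inner_δ_δ, if_pos rfl, mul_one]
  · intro v hv hne
    rw [inner_smul_left, inner_δ_δ, if_neg, mul_zero]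
    exact fun h => hne (word_injective (mem_sphere.1 hv).2 (mem_sphere.1 hz).2 h)
  · exact fun h => absurd hz h

theorem inner_sphereVec (c c' : List (Fin L) → ℂ) (k : ℕ) :
    ⟪sphereVec c k, sphereVec c' k⟫ = ∑ z ∈ sphere L k, starRingEnd ℂ (c z) * c' z := by
  conv_lhs => arg 3; rw [sphereVec]
  rw [inner_sum]
  refine Finset.sum_congr rfl fun z hz => ?_
  rw [inner_smul_right, inner_sphereVec_δ c hz, mul_comm]

theorem inner_sphereVec_of_ne (c c' : List (Fin L) → ℂ) {k k' : ℕ} (h : k ≠ k') :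
    ⟪sphereVec c k, sphereVec c' k'⟫ = 0 := by
  classical
  rw [sphereVec, sphereVec, sum_inner]
  refine Finset.sum_eq_zero fun v hv => ?_
  rw [inner_sum]
  refine Finset.sum_eq_zero fun z hz => ?_
  rw [inner_smul_left, inner_smul_right, inner_δ_δ, if_neg, mul_zero, mul_zero]
  intro e
  have := word_injective (mem_sphere.1 hv).2 (mem_sphere.1 hz).2 e
  subst this
  exact h ((mem_sphere.1 hv).1.symm.trans (mem_sphere.1 hz).1)

theorem exists_eq_sphereVec {l : ℕ} {ξ : H L} (hξ : ξ ∈ V L l) : ∃ c, ξ = sphereVec c l := by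
  classical
  refine ⟨fun z => ⟪δ (word z), ξ⟫, ?_⟩
  induction hξ using Submodule.span_induction with
  | mem x hx =>
    obtain ⟨w, hw, rfl⟩ := hx
    obtain ⟨z, hz, rfl⟩ := exists_word_eq w
    have hz' : z ∈ sphere L l := mem_sphere.2 ⟨by rw [← len_word hz, hw], hz⟩
    rw [sphereVec, Finset.sum_eq_single z]
    · rw [inner_δ_δ, if_pos rfl, one_smul]
    · intro v hv hne
      rw [inner_δ_δ, if_neg, zero_smul]
      exact fun h => hne (word_injective (mem_sphere.1 hv).2 hz h)
    · exact fun h => absurd hz' h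
  | zero => simp [sphereVec]
  | add x y _ _ hx hy =>
    conv_lhs => rw [hx, hy]
    simp only [sphereVec, inner_add_right, add_smul, Finset.sum_add_distrib]
  | smul a x _ hx =>
    conv_lhs => rw [hx]
    simp only [sphereVec, inner_smul_right, Finset.smul_sum, smul_smul]

variable (L) in
/-- The span of the basis vectors of length less than `k`. -/
def Below (k : ℕ) : Submodule ℂ (H L) :=
  Submodule.span ℂ {x : H L | ∃ w : W L, len w < k ∧ x = δ w}

theorem δ_mem_below {w : W L} {k : ℕ} (h : len w < k) : δ w ∈ Below L k :=
  Submodule.subset_span ⟨w, h, rfl⟩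

theorem map_below {A : H L →L[ℂ] H L} {k : ℕ} {S : Submodule ℂ (H L)}
    (h : ∀ w, len w < k → A (δ w) ∈ S) {x : H L} (hx : x ∈ Below L k) : A x ∈ S := by
  have : Below L k ≤ S.comap (A : H L →ₗ[ℂ] H L) := by
    rw [Below, Submodule.span_le]
    rintro _ ⟨w, hw, rfl⟩
    exact h w hw
  exact this hx

theorem proj_eq_of_sub_mem_below {Q : ℕ → H L →L[ℂ] H L}
    (hQ : ∀ (l : ℕ) (w : W L), Q l (δ w) = if len w = l then δ w else 0)
    {k : ℕ} {x y : H L} (h : x - y ∈ Below L k) : Q k x = Q k y := by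
  rw [← sub_eq_zero, ← map_sub, ← Submodule.mem_bot ℂ]
  refine map_below (fun w hw => ?_) h
  rw [hQ, if_neg hw.ne]
  exact Submodule.zero_mem _

theorem proj_sphereVec {Q : ℕ → H L →L[ℂ] H L}
    (hQ : ∀ (l : ℕ) (w : W L), Q l (δ w) = if len w = l then δ w else 0)
    (c : List (Fin L) → ℂ) (k : ℕ) : Q k (sphereVec c k) = sphereVec c k := by
  rw [sphereVec, map_sum]
  refine Finset.sum_congr rfl fun v hv => ?_
  obtain ⟨h1, h2⟩ := mem_sphere.1 hv
  rw [map_smul, hQ, if_pos ((len_word h2).trans h1)]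

/-- `A` acts on basis vectors as a Hecke generator along the map `f` of `W L`. -/
def IsHecke (p : ℂ) (f : W L → W L) (A : H L →L[ℂ] H L) : Prop :=
  ∀ w, A (δ w) = if len (f w) < len w then δ (f w) + p • δ w else δ (f w)

theorem IsHecke.map_below {p : ℂ} {f : W L → W L} {A : H L →L[ℂ] H L} (hA : IsHecke p f A)
    (hf : ∀ w, len (f w) ≤ len w + 1) {k : ℕ} {x : H L} (hx : x ∈ Below L k) :
    A x ∈ Below L (k + 1) := by
  refine UCoxMasa.map_below (fun w hw => ?_) hx
  have := hf w
  rw [hA]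
  split_ifs
  · exact Submodule.add_mem _ (δ_mem_below (by omega))
      (Submodule.smul_mem _ _ (δ_mem_below (by omega)))
  · exact δ_mem_below (by omega)

theorem len_simple_mul_le (s : Fin L) (w : W L) : len (σ s * w) ≤ len w + 1 := by
  rcases (cs L).length_simple_mul w s with h | h
  · exact h.le
  · have : len (σ s * w) + 1 = len w := h
    omega

theorem len_mul_simple_le (s : Fin L) (w : W L) : len (w * σ s) ≤ len w + 1 := by
  rcases (cs L).length_mul_simple w s with h | h
  · exact h.le
  · have : len (w * σ s) + 1 = len w := h
    omega

theorem IsHecke.apply_mem_below {p : ℂ} {f : W L → W L} {A : H L →L[ℂ] H L}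
    (hA : IsHecke p f A) {w : W L} {k : ℕ} (hw : len w < k) (hf : len (f w) < k) :
    A (δ w) ∈ Below L k := by
  rw [hA]
  split_ifs
  · exact Submodule.add_mem _ (δ_mem_below hf) (Submodule.smul_mem _ _ (δ_mem_below hw))
  · exact δ_mem_below hf

theorem IsHecke.left_sub_mem_below {p : ℂ} {s : Fin L} {A : H L →L[ℂ] H L}
    (hA : IsHecke p (σ s * ·) A) {l : List (Fin L)} (hl : Red l) [Decidable (Red (s :: l))] :
    A (δ (word l)) - (if Red (s :: l) then δ (word (s :: l)) else 0) ∈ Below L (l.length + 1) := by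
  split_ifs with h
  · have e := hA (word l)
    simp only [← word_cons] at e
    rw [e, if_neg, sub_self]
    · exact Submodule.zero_mem _
    · rw [len_word h, len_word hl, List.length_cons]
      omega
  · rw [sub_zero]
    obtain ⟨t, rfl⟩ := exists_eq_cons_of_not_red hl h
    refine hA.apply_mem_below (by rw [len_word hl]; omega) ?_
    rw [← word_cons, word_cons_cons_self, len_word (l := t) hl.tail, List.length_cons]
    omega

theorem IsHecke.right_sub_mem_below {p : ℂ} {s : Fin L} {A : H L →L[ℂ] H L}
    (hA : IsHecke p (· * σ s) A) {l : List (Fin L)} (hl : Red l)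
    [Decidable (Red (l ++ [s]))] :
    A (δ (word l)) - (if Red (l ++ [s]) then δ (word (l ++ [s])) else 0) ∈
      Below L (l.length + 1) := by
  split_ifs with h
  · have e := hA (word l)
    simp only [← word_append_singleton] at e
    rw [e, if_neg, sub_self]
    · exact Submodule.zero_mem _
    · rw [len_word h, len_word hl, List.length_append]
      simp
  · rw [sub_zero]
    obtain ⟨t, rfl⟩ := exists_eq_append_of_not_red hl h
    refine hA.apply_mem_below (by rw [len_word hl]; omega) ?_
    rw [← word_append_singleton, word_append_self, len_word hl.left_of_append,
      List.length_append]
    omega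

end Spheres

section Top

variable {L : ℕ} {p : ℂ}

theorem tsum_sphere {n : ℕ} (A : W L → H L →L[ℂ] H L) :
    ∑' w : {w : W L // len w = n}, A (w : W L) = ∑ u ∈ sphere L n, A (word u) := by
  let e : {l // l ∈ sphere L n} ≃ {w : W L // len w = n} :=
    Equiv.ofBijective
      (fun l => ⟨word l.1, (len_word (mem_sphere.1 l.2).2).trans (mem_sphere.1 l.2).1⟩) (by
        constructor
        · rintro ⟨l, hl⟩ ⟨l', hl'⟩ h
          exact Subtype.ext (word_injective (mem_sphere.1 hl).2 (mem_sphere.1 hl').2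
            (congrArg Subtype.val h))
        · rintro ⟨w, hw⟩
          obtain ⟨z, hz, rfl⟩ := exists_word_eq w
          exact ⟨⟨z, mem_sphere.2 ⟨by rw [← len_word hz, hw], hz⟩⟩, rfl⟩)
  rw [← e.tsum_eq, ← Finset.tsum_subtype]
  rfl

section Left

variable {T : Fin L → H L →L[ℂ] H L} {Tw : W L → H L →L[ℂ] H L}
  (hT : ∀ s, IsHecke p (σ s * ·) (T s)) (hTw1 : Tw 1 = 1)
  (hTwrec : ∀ (s : Fin L) (w : W L), len (σ s * w) < len w → Tw w = T s ∘L Tw (σ s * w))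

include hTwrec in
theorem left_word_cons {s : Fin L} {u : List (Fin L)} (h : Red (s :: u)) :
    Tw (word (s :: u)) = T s ∘L Tw (word u) := by
  have e : σ s * word (s :: u) = word u := by rw [← word_cons, word_cons_cons_self]
  rw [hTwrec s, e]
  rw [e, len_word h, len_word (l := u) h.tail, List.length_cons]
  omega

include hT hTw1 hTwrec

theorem left_word_map_below {u : List (Fin L)} (hu : Red u) {k : ℕ} {x : H L}
    (hx : x ∈ Below L k) : Tw (word u) x ∈ Below L (u.length + k) := by
  induction u with
  | nil =>
    have : word ([] : List (Fin L)) = 1 := (cs L).wordProd_nil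
    rw [this, hTw1]
    simpa using hx
  | cons s u ih =>
    rw [left_word_cons hTwrec hu, List.length_cons, add_right_comm]
    exact (hT s).map_below (len_simple_mul_le s) (ih hu.tail)

theorem left_word_sub_mem_below {u v : List (Fin L)} (hu : Red u) (hv : Red v) :
    Tw (word u) (δ (word v)) - (if Red (u ++ v) then δ (word (u ++ v)) else 0) ∈
      Below L (u.length + v.length) := by
  induction u with
  | nil =>
    have : word ([] : List (Fin L)) = 1 := (cs L).wordProd_nil
    rw [this, hTw1, List.nil_append, if_pos hv]
    simp
  | cons s u ih =>
    have h1 := (hT s).map_below (len_simple_mul_le s) (ih hu.tail)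
    rw [map_sub] at h1
    rw [left_word_cons hTwrec hu, List.length_cons, List.cons_append, add_right_comm]
    by_cases h : Red (u ++ v)
    · have h2 := (hT s).left_sub_mem_below h
      rw [if_pos h] at h1
      rw [List.length_append] at h2
      simpa using Submodule.add_mem _ h1 h2
    · rw [if_neg fun h' => h h'.tail]
      rw [if_neg h, map_zero] at h1
      exact h1

theorem left_sphere_map_below (m : ℕ) {k : ℕ} {x : H L} (hx : x ∈ Below L k) :
    (∑ u ∈ sphere L m, Tw (word u)) x ∈ Below L (m + k) := by
  rw [sum_apply]
  refine Submodule.sum_mem _ fun u hu => ?_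
  rw [← (mem_sphere.1 hu).1]
  exact left_word_map_below hT hTw1 hTwrec (mem_sphere.1 hu).2 hx

theorem left_sphere_sub_mem_below (m k : ℕ) (c : List (Fin L) → ℂ) :
    (∑ u ∈ sphere L m, Tw (word u)) (sphereVec c k) -
      sphereVec (fun z => c (z.drop m)) (m + k) ∈ Below L (m + k) := by
  rw [sphereVec, sphereVec, sum_sphere_add, sum_apply,
    ← Finset.sum_sub_distrib]
  refine Submodule.sum_mem _ fun u hu => ?_
  obtain ⟨hu1, hu2⟩ := mem_sphere.1 hu
  rw [map_sum, ← Finset.sum_sub_distrib]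
  refine Submodule.sum_mem _ fun v hv => ?_
  obtain ⟨hv1, hv2⟩ := mem_sphere.1 hv
  have := Submodule.smul_mem _ (c v) (left_word_sub_mem_below hT hTw1 hTwrec hu2 hv2)
  rw [hu1, hv1] at this
  convert this using 1
  rw [map_smul, smul_sub, smul_ite, smul_zero]
  simp [← hu1]

end Left

section Right

variable {T : Fin L → H L →L[ℂ] H L} {Tw : W L → H L →L[ℂ] H L}
  (hT : ∀ s, IsHecke p (· * σ s) (T s)) (hTw1 : Tw 1 = 1)
  (hTwrec : ∀ (s : Fin L) (w : W L), len (w * σ s) < len w → Tw w = T s ∘L Tw (w * σ s))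

include hTwrec in
theorem right_word_append {s : Fin L} {u : List (Fin L)} (h : Red (u ++ [s])) :
    Tw (word (u ++ [s])) = T s ∘L Tw (word u) := by
  have e : word (u ++ [s]) * σ s = word u := by rw [← word_append_singleton, word_append_self]
  rw [hTwrec s, e]
  rw [e, len_word h, len_word h.left_of_append, List.length_append]
  simp

include hT hTw1 hTwrec

theorem right_word_sub_mem_below {u v : List (Fin L)} (hu : Red u) (hv : Red v) :
    Tw (word u) (δ (word v)) - (if Red (v ++ u) then δ (word (v ++ u)) else 0) ∈
      Below L (v.length + u.length) := by
  induction u using List.reverseRecOn with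
  | nil =>
    have : word ([] : List (Fin L)) = 1 := (cs L).wordProd_nil
    rw [this, hTw1, List.append_nil, if_pos hv]
    simp
  | append_singleton u s ih =>
    have h1 := (hT s).map_below (len_mul_simple_le s) (ih hu.left_of_append)
    rw [map_sub] at h1
    rw [right_word_append hTwrec hu, List.length_append, List.length_singleton,
      ← List.append_assoc, ← add_assoc]
    by_cases h : Red (v ++ u)
    · have h2 := (hT s).right_sub_mem_below h
      rw [if_pos h] at h1
      rw [List.length_append] at h2
      simpa using Submodule.add_mem _ h1 h2
    · rw [if_neg fun h' => h h'.left_of_append]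
      rw [if_neg h, map_zero] at h1
      exact h1

theorem right_sphere_sub_mem_below (n k : ℕ) (c : List (Fin L) → ℂ) :
    (∑ u ∈ sphere L n, Tw (word u)) (sphereVec c k) -
      sphereVec (fun z => c (z.take k)) (k + n) ∈ Below L (k + n) := by
  rw [sphereVec, sphereVec, sum_sphere_add, Finset.sum_comm, sum_apply,
    ← Finset.sum_sub_distrib]
  refine Submodule.sum_mem _ fun u hu => ?_
  obtain ⟨hu1, hu2⟩ := mem_sphere.1 hu
  rw [map_sum, ← Finset.sum_sub_distrib]
  refine Submodule.sum_mem _ fun v hv => ?_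
  obtain ⟨hv1, hv2⟩ := mem_sphere.1 hv
  have := Submodule.smul_mem _ (c v) (right_word_sub_mem_below hT hTw1 hTwrec hu2 hv2)
  rw [hu1, hv1] at this
  convert this using 1
  rw [map_smul, smul_sub, smul_ite, smul_zero]
  simp [← hv1]

end Right

/-- The operators `h_m` and `h_n^r` translate the window of a sphere vector, in top degree. -/
theorem proj_left_right_sphereVec
    {T : Fin L → H L →L[ℂ] H L} (hT : ∀ s, IsHecke p (σ s * ·) (T s))
    {Tw : W L → H L →L[ℂ] H L} (hTw1 : Tw 1 = 1)
    (hTwrec : ∀ (s : Fin L) (w : W L), len (σ s * w) < len w → Tw w = T s ∘L Tw (σ s * w))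
    {Tr : Fin L → H L →L[ℂ] H L} (hTr : ∀ s, IsHecke p (· * σ s) (Tr s))
    {Twr : W L → H L →L[ℂ] H L} (hTwr1 : Twr 1 = 1)
    (hTwrrec : ∀ (s : Fin L) (w : W L), len (w * σ s) < len w → Twr w = Tr s ∘L Twr (w * σ s))
    {Q : ℕ → H L →L[ℂ] H L}
    (hQ : ∀ (l : ℕ) (w : W L), Q l (δ w) = if len w = l then δ w else 0)
    (c : List (Fin L) → ℂ) (l m n : ℕ) :
    Q (m + n + l) ((∑ u ∈ sphere L m, Tw (word u))
      ((∑ u ∈ sphere L n, Twr (word u)) (sphereVec c l))) =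
      sphereVec (fun z => c ((z.drop m).take l)) (m + n + l) := by
  have h1 := left_sphere_map_below hT hTw1 hTwrec m
    (right_sphere_sub_mem_below hTr hTwr1 hTwrrec n l c)
  have h2 := left_sphere_sub_mem_below hT hTw1 hTwrec m (l + n) (fun z => c (z.take l))
  rw [map_sub] at h1
  have h3 := Submodule.add_mem _ h1 h2
  rw [sub_add_sub_cancel, show m + (l + n) = m + n + l by ring] at h3
  rw [proj_eq_of_sub_mem_below hQ h3, proj_sphereVec hQ]

/-- Orthogonality to `S_l` makes the coefficients sum to zero over the last letter. -/
theorem sum_last_letter_eq_zero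
    {Tr : Fin L → H L →L[ℂ] H L} (hTr : ∀ s, IsHecke p (· * σ s) (Tr s))
    {Q : ℕ → H L →L[ℂ] H L}
    (hQ : ∀ (l : ℕ) (w : W L), Q l (δ w) = if len w = l then δ w else 0)
    {h : H L →L[ℂ] H L} {c : List (Fin L) → ℂ} {l : ℕ}
    (hperp : ∀ y ∈ Sl L Q h (∑ s, Tr s) (l + 1), ⟪sphereVec c (l + 1), y⟫ = 0)
    {u : List (Fin L)} (hu : u ∈ sphere L l) :
    (∑ t, if Red (u ++ [t]) then c (u ++ [t]) else 0) = 0 := by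
  obtain ⟨hu1, hu2⟩ := mem_sphere.1 hu
  have hmem : Q (l + 1) ((∑ s, Tr s) (δ (word u))) ∈ Sl L Q h (∑ s, Tr s) (l + 1) :=
    Submodule.subset_span (Or.inr ⟨δ (word u),
      Submodule.subset_span ⟨word u, (len_word hu2).trans hu1, rfl⟩, rfl⟩)
  have hsub : (∑ s, Tr s) (δ (word u)) - (∑ s, if Red (u ++ [s]) then δ (word (u ++ [s])) else 0)
      ∈ Below L (l + 1) := by
    rw [sum_apply, ← Finset.sum_sub_distrib]
    refine Submodule.sum_mem _ fun s _ => ?_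
    rw [← hu1]
    exact (hTr s).right_sub_mem_below hu2
  have := hperp _ hmem
  rw [proj_eq_of_sub_mem_below hQ hsub, map_sum, inner_sum] at this
  have h2 := congrArg (starRingEnd ℂ) this
  rw [map_zero, map_sum] at h2
  refine Eq.trans ?_ h2
  refine Finset.sum_congr rfl fun t _ => ?_
  split_ifs with hr
  · rw [hQ, if_pos (by rw [len_word hr]; simp [hu1]), inner_sphereVec_δ, Complex.conj_conj]
    exact mem_sphere.2 ⟨by simp [hu1], hr⟩
  · simp

theorem boundaryParam_neg_one {c : List (Fin L) → ℂ}
    (h : ∀ u ∈ sphere L 0, (∑ t, if Red (u ++ [t]) then c (u ++ [t]) else 0) = 0) :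
    BoundaryParam c 1 (-1) := by
  intro v k hv hlen
  have h0 := h [] (mem_sphere.2 ⟨rfl, List.isChain_nil⟩)
  simp only [List.nil_append, Red, List.isChain_singleton, if_true] at h0
  have hne : v ≠ [] := by rintro rfl; simp at hlen; omega
  have e1 : v.drop (k + 1) = [] := List.drop_eq_nil_of_le (by omega)
  have e2 : v.drop k = [v.getLast hne] := by
    have := List.drop_length_sub_one hne
    rwa [hlen, Nat.add_sub_cancel_left] at this
  simp only [red_append_singleton_iff hv hne, e1, e2, List.nil_append]
  have h2 : ∑ t : Fin L, (if v.getLast hne ≠ t then c [t] else 0) +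
      ∑ t : Fin L, (if v.getLast hne = t then c [t] else 0) = ∑ t : Fin L, c [t] := by
    rw [← Finset.sum_add_distrib]
    refine Finset.sum_congr rfl fun t _ => ?_
    by_cases ht : v.getLast hne = t <;> simp [ht]
  rw [h0, Finset.sum_ite_eq, if_pos (Finset.mem_univ _)] at h2
  push_cast
  linear_combination h2

theorem boundaryParam_zero {c : List (Fin L) → ℂ} {l : ℕ} (hl : 1 ≤ l)
    (h : ∀ u ∈ sphere L l, (∑ t, if Red (u ++ [t]) then c (u ++ [t]) else 0) = 0) :
    BoundaryParam c (l + 1) 0 := by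
  intro v k hv hlen
  have hu : (v.drop (k + 1)).length = l := by simp; omega
  have hne' : v.drop (k + 1) ≠ [] := by intro e; simp [e] at hu; omega
  have hne : v ≠ [] := by rintro rfl; simp at hlen; omega
  have := h _ (mem_sphere.2 ⟨hu, hv.drop (k + 1)⟩)
  rw [Complex.ofReal_zero, zero_mul]
  refine Eq.trans ?_ this
  refine Finset.sum_congr rfl fun t _ => ?_
  simp only [red_append_singleton_iff hv hne, red_append_singleton_iff (hv.drop _) hne',
    List.getLast_drop]

theorem BoundaryParam.hasGram {c : List (Fin L) → ℂ} {l : ℕ} {r : ℝ}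
    (h : BoundaryParam c l r) (hl : 1 ≤ l) :
    HasGram (fun i : ℕ × ℕ => sphereVec (fun z => c ((z.drop i.1).take l)) (i.1 + i.2 + l))
      (‖sphereVec c l‖ ^ 2) ((L : ℝ) - 1) r where
  graded m n m' n' hne := inner_sphereVec_of_ne _ _ (by dsimp only; omega)
  toeplitz m k n := by
    dsimp only
    rw [show m + (n + k) + l = m + k + n + l by ring, inner_sphereVec]
    have h0 : corr c l l 0 0 = ((‖sphereVec c l‖ ^ 2 : ℝ) : ℂ) := by
      have := inner_self_eq_norm_sq_to_K (𝕜 := ℂ) (sphereVec c l)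
      rw [inner_sphereVec] at this
      push_cast
      refine Eq.trans ?_ this
      refine Finset.sum_congr rfl fun z hz => ?_
      rw [List.drop_zero, List.take_of_length_le (mem_sphere.1 hz).1.le]
    have := h.corr_eq hl m k n
    rw [corr, h0] at this
    rw [this]
    push_cast
    ring

end Top

theorem statement15
    (L : ℕ) (hL : 3 ≤ L) (q p : ℝ) (hq : 0 < q) (hq1 : q ≤ 1)
    (hp : p = (q - 1) / Real.sqrt q)
    (T : Fin L → H L →L[ℂ] H L)
    (hT : ∀ (s : Fin L) (w : W L),
      T s (δ w) =
        if len (σ s * w) < len w then δ (σ s * w) + (p : ℂ) • δ w else δ (σ s * w))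
    (h : H L →L[ℂ] H L) (hh : h = ∑ s, T s)
    (Tw : W L → H L →L[ℂ] H L) (hTw1 : Tw 1 = 1)
    (hTwrec : ∀ (s : Fin L) (w : W L), len (σ s * w) < len w →
      Tw w = T s ∘L Tw (σ s * w))
    (hn : ℕ → H L →L[ℂ] H L)
    (hhn : ∀ n : ℕ, hn n = ∑' w : {w : W L // len w = n}, Tw (w : W L))
    (Tr : Fin L → H L →L[ℂ] H L)
    (hTr : ∀ (s : Fin L) (w : W L),
      Tr s (δ w) =
        if len (w * σ s) < len w then δ (w * σ s) + (p : ℂ) • δ w else δ (w * σ s))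
    (Rh : H L →L[ℂ] H L) (hRh : Rh = ∑ s, Tr s)
    (Twr : W L → H L →L[ℂ] H L) (hTwr1 : Twr 1 = 1)
    (hTwrrec : ∀ (s : Fin L) (w : W L), len (w * σ s) < len w →
      Twr w = Tr s ∘L Twr (w * σ s))
    (hnr : ℕ → H L →L[ℂ] H L)
    (hhnr : ∀ n : ℕ, hnr n = ∑' w : {w : W L // len w = n}, Twr (w : W L))
    (Q : ℕ → H L →L[ℂ] H L)
    (hQ : ∀ (l : ℕ) (w : W L), Q l (δ w) = if len w = l then δ w else 0)
    (l : ℕ) (hl : 2 ≤ l)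
    (β : H L) (hβ0 : β ≠ 0)
    (hβmem : β ∈ V L 1)
    (hβperp : ∀ y ∈ Sl L Q h Rh 1, ⟪β, y⟫ = 0)
    (γ : H L) (hγ0 : γ ≠ 0)
    (hγmem : γ ∈ V L l)
    (hγperp : ∀ y ∈ Sl L Q h Rh l, ⟪γ, y⟫ = 0)
    (Xb Xg : Submodule ℂ (H L))
    (hXb : Xb = (Submodule.span ℂ (Set.range fun mn : ℕ × ℕ =>
      Q (mn.1 + mn.2 + 1) (hn mn.1 (hnr mn.2 β)))).topologicalClosure)
    (hXg : Xg = (Submodule.span ℂ (Set.range fun mn : ℕ × ℕ =>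
      Q (mn.1 + mn.2 + l) (hn mn.1 (hnr mn.2 γ)))).topologicalClosure) :
    ∃ T : Xb ≃L[ℂ] Xg, ∀ (m n : ℕ)
      (hmem : Q (m + n + 1) (hn m (hnr n β)) ∈ Xb),
      (T ⟨Q (m + n + 1) (hn m (hnr n β)), hmem⟩ : H L) =
        Q (m + n + l) (hn m (hnr n γ)) +
          (if m = 0 ∨ n = 0 then 0
            else Q (m - 1 + (n - 1) + l) (hn (m - 1) (hnr (n - 1) γ))) := by
  subst hRh
  have hT' : ∀ s, IsHecke (p : ℂ) (σ s * ·) (T s) := hT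
  have hTr' : ∀ s, IsHecke (p : ℂ) (· * σ s) (Tr s) := hTr
  obtain ⟨l, rfl⟩ := Nat.exists_eq_add_of_le' (show 1 ≤ l by omega)
  obtain ⟨b, rfl⟩ := exists_eq_sphereVec hβmem
  obtain ⟨c, rfl⟩ := exists_eq_sphereVec hγmem
  have hb := (boundaryParam_neg_one fun u hu =>
    sum_last_letter_eq_zero hTr' hQ hβperp hu).hasGram le_rfl
  have hc := (boundaryParam_zero (by omega) fun u hu =>
    sum_last_letter_eq_zero hTr' hQ hγperp hu).hasGram (by omega)
  have hd : (2 : ℝ) ≤ (L : ℝ) - 1 := by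
    have : (3 : ℝ) ≤ L := by exact_mod_cast hL
    linarith
  have key := fun a k m n => proj_left_right_sphereVec hT' hTw1 hTwrec hTr' hTwr1 hTwrrec hQ a k m n
  simp only [← tsum_sphere, ← hhn, ← hhnr] at key
  simp only [key] at hXb hXg
  subst hXb hXg
  obtain ⟨E, hE⟩ := hb.exists_equiv hc (by positivity) (by positivity) hd
  refine ⟨E, fun m n hmem => ?_⟩
  have hmem' := hmem
  rw [key] at hmem'
  refine (congrArg (fun z => (E z : H L)) (Subtype.ext (key b 1 m n) : _ = ⟨_, hmem'⟩)).trans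
    ((hE (m, n) hmem').trans ?_)
  simp only [diagFamily, key]

end UCoxMasa
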